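/- Let z>0 and let μ be a measure on (0,1) with ∫_{(0,1)} u² μ(du) < ∞ and μ([1/(1+z),1)) < ∞. For integers n ≥ 1 and r∈[0,1]: z (1−r) ∫_{(0,1)} [ (r(1−u))^n − r^n + (u/(1−u))·n r^n·1_{u < 1/(1+z)} ] μ(du) = (r^{n+1} − r^n)·[ Σ_{k=2}^{n} C(n,k)·z·( λ_{n,k}(1) − k·λ_{n,k}(1/(1+z)) ) − z n ∫_{(0,1/(1+z))} u²/(1−u) μ(du) + n z ∫_{[1/(1+z),1)} (1−u)^{n−1} u μ(du) ], where all integrals on both sides are finite. -/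

import Mathlib

open MeasureTheory Set Finset


lemma aux_range (n : ℕ) (hn : 1 ≤ n) (f : ℕ → ℝ) :
    ∑ k ∈ Finset.range (n + 1), f k = f 0 + f 1 + ∑ k ∈ Finset.Icc 2 n, f k := by
  have h : Finset.Icc 2 n = Finset.Ico 2 (n + 1) := by ext; simp
  rw [h, Finset.range_eq_Ico, Finset.sum_eq_sum_Ico_succ_bot (by omega),
    Finset.sum_eq_sum_Ico_succ_bot (by omega)]
  ring

lemma aux_sum0 (n : ℕ) (hn : 1 ≤ n) (u : ℝ) :
    ∑ k ∈ Finset.Icc 2 n, (n.choose k : ℝ) * ((1 - u) ^ (n - k) * u ^ k)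
      = 1 - (1 - u) ^ n - n * ((1 - u) ^ (n - 1) * u) := by
  have h := congrArg (Polynomial.eval u) (bernsteinPolynomial.sum ℝ n)
  rw [Polynomial.eval_finsetSum, aux_range n hn] at h
  simp [bernsteinPolynomial] at h
  have e : ∑ k ∈ Finset.Icc 2 n, (n.choose k : ℝ) * ((1 - u) ^ (n - k) * u ^ k)
      = ∑ k ∈ Finset.Icc 2 n, (n.choose k : ℝ) * u ^ k * (1 - u) ^ (n - k) :=
    Finset.sum_congr rfl fun k _ => by ring
  rw [e]; linarith

lemma aux_sum1 (n : ℕ) (hn : 1 ≤ n) (u : ℝ) :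
    ∑ k ∈ Finset.Icc 2 n, (n.choose k : ℝ) * (k * ((1 - u) ^ (n - k) * u ^ k))
      = n * u - n * ((1 - u) ^ (n - 1) * u) := by
  have h := congrArg (Polynomial.eval u) (bernsteinPolynomial.sum_smul ℝ n)
  rw [Polynomial.eval_finsetSum, aux_range n hn] at h
  simp [bernsteinPolynomial] at h
  have e : ∑ k ∈ Finset.Icc 2 n, (n.choose k : ℝ) * (k * ((1 - u) ^ (n - k) * u ^ k))
      = ∑ k ∈ Finset.Icc 2 n, (k : ℝ) * ((n.choose k : ℝ) * u ^ k * (1 - u) ^ (n - k)) :=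
    Finset.sum_congr rfl fun k _ => by ring
  rw [e]; linarith

/-- Contribution of the second population's jump measure (pushed forward to `(0,1)`) to the
generator of the Λ-asymmetric frequency process applied to `H(n,r) = r^n`:
all the integrals involved are finite and these jumps contribute only branching-type
(selection) terms to the moment dual. -/
theorem stmt16 (z : ℝ) (hz : 0 < z) (μ : Measure ℝ)
    (hμsupp : μ (Ioo (0:ℝ) 1)ᶜ = 0)
    (hμ2 : ∫⁻ u in Ioo (0:ℝ) 1, ENNReal.ofReal (u ^ 2) ∂μ < ⊤)
    (hμfin : μ (Ico (1 / (1 + z)) 1) < ⊤)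
    (n : ℕ) (hn : 1 ≤ n) (r : ℝ) (hr : r ∈ Icc (0:ℝ) 1) :
    IntegrableOn (fun u => (r * (1 - u)) ^ n - r ^ n +
        (u / (1 - u)) * n * r ^ n *
          (if u < 1 / (1 + z) then (1:ℝ) else 0)) (Ioo (0:ℝ) 1) μ ∧
    (∀ k, 2 ≤ k → k ≤ n →
      IntegrableOn (fun u => (1 - u) ^ (n - k) * u ^ k) (Ioo (0:ℝ) 1) μ) ∧
    IntegrableOn (fun u => u ^ 2 / (1 - u)) (Ioo (0:ℝ) (1 / (1 + z))) μ ∧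
    IntegrableOn (fun u => (1 - u) ^ (n - 1) * u) (Ico (1 / (1 + z)) 1) μ ∧
    z * (1 - r) * (∫ u in Ioo (0:ℝ) 1, ((r * (1 - u)) ^ n - r ^ n +
        (u / (1 - u)) * n * r ^ n *
          (if u < 1 / (1 + z) then (1:ℝ) else 0)) ∂μ) =
      (r ^ (n + 1) - r ^ n) *
        ((∑ k ∈ Finset.Icc 2 n, (n.choose k : ℝ) * z *
            ((∫ u in Ioo (0:ℝ) 1, (1 - u) ^ (n - k) * u ^ k ∂μ)
              - (k : ℝ) * ∫ u in Ioo (0:ℝ) (1 / (1 + z)), (1 - u) ^ (n - k) * u ^ k ∂μ))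
          - z * n * (∫ u in Ioo (0:ℝ) (1 / (1 + z)), u ^ 2 / (1 - u) ∂μ)
          + n * z * (∫ u in Ico (1 / (1 + z)) 1, (1 - u) ^ (n - 1) * u ∂μ)) := by
  set a : ℝ := 1 / (1 + z) with ha
  have ha0 : 0 < a := by positivity
  have ha1 : a < 1 := by rw [ha, div_lt_one (by linarith)]; linarith
  have hsq : IntegrableOn (fun u : ℝ => u ^ 2) (Ioo (0:ℝ) 1) μ := by
    refine ⟨by fun_prop, ?_⟩
    rw [hasFiniteIntegral_iff_ofReal (Filter.Eventually.of_forall fun u => sq_nonneg u)]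
    exact hμ2
  have hsub : Ioo (0:ℝ) a ⊆ Ioo 0 1 := Ioo_subset_Ioo_right ha1.le
  have hsub2 : Ico a 1 ⊆ Ioo 0 1 := fun x hx => ⟨lt_of_lt_of_le ha0 hx.1, hx.2⟩
  have hg : ∀ k, 2 ≤ k → k ≤ n →
      IntegrableOn (fun u : ℝ => (1 - u) ^ (n - k) * u ^ k) (Ioo (0:ℝ) 1) μ := by
    intro k hk _
    refine Integrable.mono' hsq (by fun_prop) ?_
    refine (ae_restrict_iff' measurableSet_Ioo).2 (Filter.Eventually.of_forall fun u hu => ?_)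
    have h0 : 0 ≤ 1 - u := by linarith [hu.2]
    have hu0 := hu.1.le
    rw [Real.norm_of_nonneg (by positivity)]
    calc (1 - u) ^ (n - k) * u ^ k ≤ 1 * u ^ 2 := by
          gcongr ?_ * ?_
          · exact pow_le_one₀ h0 (by linarith)
          · exact pow_le_pow_of_le_one hu0 hu.2.le hk
      _ = u ^ 2 := one_mul _
  have hq : IntegrableOn (fun u : ℝ => u ^ 2 / (1 - u)) (Ioo (0:ℝ) a) μ := by
    refine Integrable.mono' ((hsq.mono_set hsub).div_const (1 - a))
      (Measurable.aestronglyMeasurable (by fun_prop)) ?_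
    refine (ae_restrict_iff' measurableSet_Ioo).2 (Filter.Eventually.of_forall fun u hu => ?_)
    have h0 : 0 < 1 - u := by linarith [hu.2]
    have h1 : 0 < 1 - a := by linarith
    rw [Real.norm_of_nonneg (by positivity)]
    have := hu.2.le
    gcongr
  have hh : IntegrableOn (fun u : ℝ => (1 - u) ^ (n - 1) * u) (Ico a 1) μ := by
    refine Integrable.mono' (g := fun _ => (1:ℝ)) (integrableOn_const hμfin.ne) (by fun_prop) ?_
    refine (ae_restrict_iff' measurableSet_Ico).2 (Filter.Eventually.of_forall fun u hu => ?_)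
    have h0 : 0 ≤ 1 - u := by linarith [hu.2]
    have hu0 : 0 ≤ u := by linarith [hu.1]
    rw [Real.norm_of_nonneg (by positivity)]
    exact mul_le_one₀ (pow_le_one₀ h0 (by linarith)) hu0 hu.2.le
  -- pointwise decomposition
  let A : ℕ → ℝ → ℝ := fun k u => (1 - u) ^ (n - k) * u ^ k
  let B : ℕ → ℝ → ℝ := fun k => (Ioo (0:ℝ) a).indicator (A k)
  let Q : ℝ → ℝ := (Ioo (0:ℝ) a).indicator (fun u => u ^ 2 / (1 - u))
  let H : ℝ → ℝ := (Ico a 1).indicator (fun u => (1 - u) ^ (n - 1) * u)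
  let S : ℝ → ℝ := fun u => ∑ k ∈ Finset.Icc 2 n, (n.choose k : ℝ) * (A k u - k * B k u)
  have hB : ∀ k, 2 ≤ k → k ≤ n → IntegrableOn (B k) (Ioo 0 1) μ := fun k h1 h2 =>
    (hg k h1 h2).indicator measurableSet_Ioo
  have hQ : IntegrableOn Q (Ioo 0 1) μ :=
    (((integrable_indicator_iff measurableSet_Ioo).2 hq).integrableOn)
  have hH : IntegrableOn H (Ioo 0 1) μ :=
    (((integrable_indicator_iff measurableSet_Ico).2 hh).integrableOn)
  have hT : ∀ k ∈ Finset.Icc 2 n,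
      IntegrableOn (fun u => (n.choose k : ℝ) * (A k u - k * B k u)) (Ioo 0 1) μ := by
    intro k hk
    rw [Finset.mem_Icc] at hk
    exact ((hg k hk.1 hk.2).sub ((hB k hk.1 hk.2).const_mul _)).const_mul _
  have hS : IntegrableOn S (Ioo 0 1) μ := integrable_finsetSum _ hT
  have hpt : ∀ u ∈ Ioo (0:ℝ) 1, (r * (1 - u)) ^ n - r ^ n +
        (u / (1 - u)) * n * r ^ n * (if u < a then (1:ℝ) else 0)
      = -r ^ n * (S u - n * Q u + n * H u) := by
    intro u hu
    have h0 : 1 - u ≠ 0 := by linarith [hu.2]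
    by_cases hua : u < a
    · have m1 : u ∈ Ioo 0 a := ⟨hu.1, hua⟩
      have m2 : u ∉ Ico a 1 := fun h => absurd h.1 (not_le.2 hua)
      have hSu : S u = (1 - (1 - u) ^ n - n * ((1 - u) ^ (n - 1) * u))
          - (n * u - n * ((1 - u) ^ (n - 1) * u)) := by
        rw [← aux_sum0 n hn, ← aux_sum1 n hn, ← Finset.sum_sub_distrib]
        refine Finset.sum_congr rfl fun k _ => ?_
        simp only [A, B, indicator_of_mem m1]; ring
      simp only [hSu, Q, H, indicator_of_mem m1, indicator_of_notMem m2, if_pos hua, mul_pow]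
      field_simp
      ring
    · have m1 : u ∉ Ioo 0 a := fun h => hua h.2
      have m2 : u ∈ Ico a 1 := ⟨not_lt.1 hua, hu.2⟩
      have hSu : S u = 1 - (1 - u) ^ n - n * ((1 - u) ^ (n - 1) * u) := by
        rw [← aux_sum0 n hn]
        refine Finset.sum_congr rfl fun k _ => ?_
        simp only [A, B, indicator_of_notMem m1]; ring
      simp only [hSu, Q, H, indicator_of_mem m2, indicator_of_notMem m1, if_neg hua, mul_pow]
      ring
  have hint : IntegrableOn (fun u => -r ^ n * (S u - n * Q u + n * H u)) (Ioo 0 1) μ :=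
    ((hS.sub (hQ.const_mul _)).add (hH.const_mul _)).const_mul _
  refine ⟨hint.congr_fun (fun u hu => (hpt u hu).symm) measurableSet_Ioo, hg, hq, hh, ?_⟩
  rw [setIntegral_congr_fun measurableSet_Ioo hpt, integral_const_mul,
    integral_add (f := fun u => S u - n * Q u) (hS.sub (hQ.const_mul _)) (hH.const_mul _),
    integral_sub hS (hQ.const_mul _), integral_const_mul, integral_const_mul]
  have eQ : ∫ u in Ioo 0 1, Q u ∂μ = ∫ u in Ioo 0 a, u ^ 2 / (1 - u) ∂μ := by
    rw [setIntegral_indicator measurableSet_Ioo, inter_eq_right.2 hsub]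
  have eH : ∫ u in Ioo 0 1, H u ∂μ = ∫ u in Ico a 1, (1 - u) ^ (n - 1) * u ∂μ := by
    rw [setIntegral_indicator measurableSet_Ico, inter_eq_right.2 hsub2]
  have eS : z * ∫ u in Ioo 0 1, S u ∂μ = ∑ k ∈ Finset.Icc 2 n, (n.choose k : ℝ) * z *
            ((∫ u in Ioo (0:ℝ) 1, (1 - u) ^ (n - k) * u ^ k ∂μ)
              - (k : ℝ) * ∫ u in Ioo (0:ℝ) a, (1 - u) ^ (n - k) * u ^ k ∂μ) := by
    rw [integral_finsetSum _ hT, Finset.mul_sum]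
    refine Finset.sum_congr rfl fun k hk => ?_
    rw [Finset.mem_Icc] at hk
    rw [integral_const_mul, integral_sub (hg k hk.1 hk.2) ((hB k hk.1 hk.2).const_mul _),
      integral_const_mul, setIntegral_indicator measurableSet_Ioo, inter_eq_right.2 hsub]
    ring
  rw [← eS, eQ, eH]
  ring
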